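/- Let k ∈ ℤ, let x₁, x₂ ≤ k be integers, and let ω₁, ω₂ ∈ Ω₊ be cookie environments with ω₁(x) = ω₂(x) for all x ≥ k. Then the sequence (X_{τ_{k,m}})_{m≥0} has the same distribution under P_{x₁,ω₁} as under P_{x₂,ω₂}. In particular, P_{x₁,ω₁}[R_k] = P_{x₂,ω₂}[R_k]. -/

import Mathlib

open MeasureTheory Filter Set Topology ProbabilityTheory
open scoped ENNReal ENat

noncomputable section

/-- A cookie environment: `ω z i` is the strength of the `(i+1)`-st cookie at site `z`
(cookies at each site are indexed by `i = 0, 1, 2, …`). -/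
abbrev CEnv : Type := ℤ → ℕ → ℝ

/-- `ω` belongs to `Ω₊`, i.e. all cookie strengths lie in `[1/2, 1]`. -/
def IsCookieEnv (ω : CEnv) : Prop := ∀ z i, ω z i ∈ Set.Icc (1/2 : ℝ) 1

/-- The number of visits of the path `x` to the site `x n` at times `m < n`. -/
def prevVisits (x : ℕ → ℤ) (n : ℕ) : ℕ :=
  ((Finset.range n).filter fun m => x m = x n).card

/-- The probability of the step from `x n` to `x (n+1)` for the multi-excited random
walk: jump to the right with the strength of the bottom remaining cookie at the current
site, to the left with the complementary probability. -/
def stepProb (ω : CEnv) (x : ℕ → ℤ) (n : ℕ) : ℝ :=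
  if x (n+1) = x n + 1 then ω (x n) (prevVisits x n)
  else if x (n+1) = x n - 1 then 1 - ω (x n) (prevVisits x n)
  else 0

/-- The probability that the walk started at `x0` follows the path `x` up to time `n`. -/
def cylProb (ω : CEnv) (x0 : ℤ) (x : ℕ → ℤ) (n : ℕ) : ℝ :=
  (if x 0 = x0 then 1 else 0) * ∏ m ∈ Finset.range n, stepProb ω x m

/-- `P` is the law `P_{x0,ω}` of the multi-excited random walk in the cookie
environment `ω` started at `x0`, characterized by its cylinder probabilities. -/
def IsERWLaw (ω : CEnv) (x0 : ℤ) (P : Measure (ℕ → ℤ)) : Prop :=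
  IsProbabilityMeasure P ∧
    ∀ (x : ℕ → ℤ) (n : ℕ),
      P {Y | ∀ m ≤ n, Y m = x m} = ENNReal.ofReal (cylProb ω x0 x n)

/-- First passage time `T_k`, with value `∞` if `k` is never visited. -/
def T (k : ℤ) (Y : ℕ → ℤ) : ℕ∞ :=
  sInf {t : ℕ∞ | ∃ n : ℕ, (n : ℕ∞) = t ∧ Y n = k}

/-- First passage time of an extended-real level, with the convention
`T_{−∞} = T_{+∞} = ∞`. -/
def Te (k : EReal) (Y : ℕ → ℤ) : ℕ∞ :=
  sInf {t : ℕ∞ | ∃ n : ℕ, (n : ℕ∞) = t ∧ ((Y n : ℝ) : EReal) = k}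

/-- `R_k`, the event that the site `k` is visited infinitely often. -/
def Rset (k : ℤ) : Set (ℕ → ℤ) := {Y | ∀ N : ℕ, ∃ n ≥ N, Y n = k}

/-- The number of visits of `Y` to the site `s` at times `< t`. -/
def visitsBefore (Y : ℕ → ℤ) (s : ℤ) (t : ℕ∞) : ℕ∞ :=
  {m : ℕ | (m : ℕ∞) < t ∧ Y m = s}.encard

/-- `D_t^s`: the total drift stored in the cookies consumed at the site `s`
before time `t` (a time in `ℕ∞`; `t = ∞` gives `D_∞^s`). -/
def driftAt (ω : CEnv) (Y : ℕ → ℤ) (s : ℤ) (t : ℕ∞) : ℝ≥0∞ :=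
  ∑' i : ℕ, Set.indicator {i : ℕ | (i : ℕ∞) < visitsBefore Y s t}
    (fun i => ENNReal.ofReal (2 * ω s i - 1)) i

/-- `D_t`: the total drift consumed before time `t` (at all sites). -/
def Dtot (ω : CEnv) (Y : ℕ → ℤ) (t : ℕ∞) : ℝ≥0∞ := ∑' s : ℤ, driftAt ω Y s t

/-- `D_t^+`: the total drift consumed at nonnegative sites before time `t`. -/
def DtotPos (ω : CEnv) (Y : ℕ → ℤ) (t : ℕ∞) : ℝ≥0∞ := ∑' s : ℕ, driftAt ω Y (s : ℤ) t

/-- `δ^s`: the total drift stored in the cookies at the site `s`. -/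
def cookieDrift (ω : CEnv) (s : ℤ) : ℝ≥0∞ := ∑' i : ℕ, ENNReal.ofReal (2 * ω s i - 1)

/-- The successive times `τ_{k,1}, τ_{k,2}, …` (indexed here from `0`) at which the
walk is at a site `≥ k`. -/
def tauT (k : ℤ) (Y : ℕ → ℤ) : ℕ → ℕ∞
  | 0 => sInf {t : ℕ∞ | ∃ n : ℕ, (n : ℕ∞) = t ∧ k ≤ Y n}
  | m + 1 => sInf {t : ℕ∞ | ∃ n : ℕ, (n : ℕ∞) = t ∧ tauT k Y m < (n : ℕ∞) ∧ k ≤ Y n}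

/-- The observed sequence `(X_{τ_{k,m}})_{m ≥ 1}` (indexed here from `0`). -/
def obsSeq (k : ℤ) (Y : ℕ → ℤ) (m : ℕ) : ℤ := Y (tauT k Y m).toNat

/-- The one-sided shift on sequences. -/
def shiftSeq {α : Type*} (u : ℕ → α) : ℕ → α := fun n => u (n + 1)

/-- The restriction `(ω(x))_{x ≥ 0}` of an environment to the nonnegative sites. -/
def restrictNN (ω : CEnv) : ℕ → ℕ → ℝ := fun x => ω (x : ℤ)

/-- `(ω(x))_{x ≥ 0}` is stationary under `Pr`: its law is invariant under the shift. -/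
def IsStationaryEnv (Pr : Measure CEnv) : Prop :=
  MeasurePreserving shiftSeq (Pr.map restrictNN) (Pr.map restrictNN)

/-- `(ω(x))_{x ≥ 0}` is stationary and ergodic under `Pr`. -/
def IsStatErgEnv (Pr : Measure CEnv) : Prop :=
  Ergodic shiftSeq (Pr.map restrictNN)

/-- The process `ξ_k = ((ω(x+k))_{x≥0}, (X_{τ_{k,m}} − k)_{m≥0})` consisting of the
environment to the right of `k` and the trajectory at sites `≥ k`, recentered at `k`. -/
def xiProc (p : CEnv × (ℕ → ℤ)) (k : ℕ) : (ℕ → ℕ → ℝ) × (ℕ → ℤ) :=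
  (fun x : ℕ => p.1 ((x : ℤ) + (k : ℤ)), fun m => obsSeq (k : ℤ) p.2 m - (k : ℤ))

/-- The cylinder of trajectories following `x` up to time `n`. -/
def cyl (x : ℕ → ℤ) (n : ℕ) : Set (ℕ → ℤ) := {Y | ∀ m ≤ n, Y m = x m}

/-- The extension by zero of a finite trajectory. -/
def pathExt {n : ℕ} (h : Fin (n + 1) → ℤ) : ℕ → ℤ :=
  fun m => if hm : m < n + 1 then h ⟨m, hm⟩ else 0

lemma measurableSet_cyl (x : ℕ → ℤ) (n : ℕ) : MeasurableSet (cyl x n) := by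
  have : cyl x n = ⋂ m, ⋂ (_ : m ≤ n), (fun Y : ℕ → ℤ => Y m) ⁻¹' {x m} := by
    ext Y; simp [cyl]
  rw [this]
  exact MeasurableSet.iInter fun m => MeasurableSet.iInter fun _ =>
    measurable_pi_apply m (measurableSet_singleton _)

lemma mem_cyl_pathExt_iff {n : ℕ} (h : Fin (n + 1) → ℤ) (Y : ℕ → ℤ) :
    Y ∈ cyl (pathExt h) n ↔ (fun i : Fin (n + 1) => Y i) = h := by
  constructor
  · intro hY
    ext i
    have := hY i (by omega)
    exact this.trans (dif_pos i.2)
  · rintro rfl m hm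
    simp [pathExt, Nat.lt_succ_of_le hm]

lemma pairwise_disjoint_cyl_pathExt (n : ℕ) :
    Pairwise (Function.onFun Disjoint fun h : Fin (n + 1) → ℤ => cyl (pathExt h) n) := by
  intro h h' hne
  refine Set.disjoint_left.2 fun Y hY hY' => hne ?_
  rw [mem_cyl_pathExt_iff] at hY hY'
  exact hY.symm.trans hY'

lemma iUnion_cyl_pathExt (n : ℕ) :
    ⋃ h : Fin (n + 1) → ℤ, cyl (pathExt h) n = univ :=
  eq_univ_of_forall fun Y => mem_iUnion.2 ⟨_, (mem_cyl_pathExt_iff _ Y).2 rfl⟩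

lemma lintegral_eq_tsum_cyl (P : Measure (ℕ → ℤ)) (n : ℕ) (F : (ℕ → ℤ) → ℝ≥0∞) :
    ∫⁻ Y, F Y ∂P = ∑' h : Fin (n + 1) → ℤ, ∫⁻ Y in cyl (pathExt h) n, F Y ∂P := by
  rw [← lintegral_iUnion (fun h => measurableSet_cyl _ n) (pairwise_disjoint_cyl_pathExt n),
    iUnion_cyl_pathExt, Measure.restrict_univ]

lemma lintegral_le_of_cyl (P : Measure (ℕ → ℤ)) (n : ℕ) {F G : (ℕ → ℤ) → ℝ≥0∞}
    (h : ∀ x, ∫⁻ Y in cyl x n, F Y ∂P ≤ ∫⁻ Y in cyl x n, G Y ∂P) :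
    ∫⁻ Y, F Y ∂P ≤ ∫⁻ Y, G Y ∂P := by
  rw [lintegral_eq_tsum_cyl P n F, lintegral_eq_tsum_cyl P n G]
  exact ENNReal.tsum_le_tsum fun _ => h _

lemma measure_eq_tsum_cyl (P : Measure (ℕ → ℤ)) (n : ℕ) (S : Set (ℕ → ℤ)) :
    P S = ∑' h : Fin (n + 1) → ℤ, P (cyl (pathExt h) n ∩ S) := by
  have := lintegral_eq_tsum_cyl (P.restrict S) n 1
  simpa [Measure.restrict_apply (measurableSet_cyl _ n)] using this

lemma measure_eq_mul_of_cyl (P : Measure (ℕ → ℤ)) (n : ℕ) {S S' : Set (ℕ → ℤ)} {c : ℝ≥0∞}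
    (h : ∀ x, P (cyl x n ∩ S) = c * P (cyl x n ∩ S')) : P S = c * P S' := by
  rw [measure_eq_tsum_cyl P n S, measure_eq_tsum_cyl P n S', ← ENNReal.tsum_mul_left]
  exact tsum_congr fun _ => h _

lemma measure_eq_zero_of_cyl (P : Measure (ℕ → ℤ)) (n : ℕ) {S : Set (ℕ → ℤ)}
    (h : ∀ x, P (cyl x n ∩ S) = 0) : P S = 0 := by
  rw [measure_eq_tsum_cyl P n S]
  simp [h]

/-- `E` is determined by the trajectory up to time `n`. -/
def IsAdaptedSet (n : ℕ) (E : Set (ℕ → ℤ)) : Prop :=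
  ∀ Y Y' : ℕ → ℤ, (∀ m ≤ n, Y m = Y' m) → Y ∈ E → Y' ∈ E

lemma IsAdaptedSet.cyl_subset {n : ℕ} {E : Set (ℕ → ℤ)} (hE : IsAdaptedSet n E) {x : ℕ → ℤ}
    (hx : x ∈ E) : cyl x n ⊆ E :=
  fun _ hY => hE x _ (fun m hm => (hY m hm).symm) hx

lemma IsAdaptedSet.cyl_inter_eq_empty {n : ℕ} {E : Set (ℕ → ℤ)} (hE : IsAdaptedSet n E)
    {x : ℕ → ℤ} (hx : x ∉ E) : cyl x n ∩ E = ∅ :=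
  eq_empty_of_forall_notMem fun Y hY => hx (hE Y x hY.1 hY.2)

lemma IsAdaptedSet.measurableSet {n : ℕ} {E : Set (ℕ → ℤ)} (hE : IsAdaptedSet n E) :
    MeasurableSet E := by
  have : E = ⋃ h : Fin (n + 1) → ℤ, ⋃ (_ : pathExt h ∈ E), cyl (pathExt h) n := by
    refine subset_antisymm (fun Y hY => ?_) (iUnion₂_subset fun h hh => hE.cyl_subset hh)
    have hY' := (mem_cyl_pathExt_iff (n := n) _ Y).2 rfl
    exact mem_iUnion₂.2 ⟨_, hE Y _ hY' hY, hY'⟩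
  rw [this]
  exact MeasurableSet.iUnion fun h => MeasurableSet.iUnion fun _ => measurableSet_cyl _ n

/-- Two finite measures on trajectories which agree on cylinders are equal. -/
lemma measure_ext_of_cyl {P Q : Measure (ℕ → ℤ)} [IsFiniteMeasure P]
    (h : ∀ x n, P (cyl x n) = Q (cyl x n)) : P = Q := by
  have huniv : P univ = Q univ := by
    rw [measure_eq_tsum_cyl P 0, measure_eq_tsum_cyl Q 0]
    simp [h]
  refine ext_of_generate_finite (insert ∅ {S | ∃ x n, S = cyl x n}) ?_ ?_ ?_ huniv
  · refine le_antisymm ?_ (MeasurableSpace.generateFrom_le ?_)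
    · refine iSup_le fun n => ?_
      rw [← measurable_iff_comap_le]
      refine @measurable_to_countable' _ _ _ _ (MeasurableSpace.generateFrom _) _ fun w => ?_
      have : (fun Y : ℕ → ℤ => Y n) ⁻¹' {w} =
          ⋃ h : Fin (n + 1) → ℤ, ⋃ (_ : pathExt h n = w), cyl (pathExt h) n := by
        ext Y
        simp only [mem_preimage, mem_singleton_iff, mem_iUnion, exists_prop]
        constructor
        · rintro rfl
          have hY' := (mem_cyl_pathExt_iff (n := n) _ Y).2 rfl
          exact ⟨_, (hY' n le_rfl).symm, hY'⟩
        · rintro ⟨h, rfl, hY⟩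
          exact hY n le_rfl
      rw [this]
      exact MeasurableSet.iUnion fun h => MeasurableSet.iUnion fun _ =>
        MeasurableSpace.measurableSet_generateFrom (Or.inr ⟨_, _, rfl⟩)
    · rintro S (rfl | ⟨x, n, rfl⟩)
      · exact MeasurableSet.empty
      · exact measurableSet_cyl x n
  · rintro S (rfl | ⟨x, n, rfl⟩) S' (rfl | ⟨x', n', rfl⟩) hne
    · simp at hne
    · simp at hne
    · simp at hne
    · obtain ⟨Z, hZ, hZ'⟩ := hne
      refine Or.inr ⟨Z, max n n', ?_⟩
      ext Y
      constructor
      · rintro ⟨hY, hY'⟩ m hm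
        rcases le_max_iff.1 hm with hm | hm
        · rw [hY m hm, hZ m hm]
        · rw [hY' m hm, hZ' m hm]
      · intro hY
        exact ⟨fun m hm => (hY m (le_max_of_le_left hm)).trans (hZ m hm),
          fun m hm => (hY m (le_max_of_le_right hm)).trans (hZ' m hm)⟩
  · rintro S (rfl | ⟨x, n, rfl⟩)
    · simp
    · exact h x n

lemma prevVisits_congr {x y : ℕ → ℤ} {n : ℕ} (h : ∀ m ≤ n, x m = y m) :
    prevVisits x n = prevVisits y n := by
  unfold prevVisits
  congr 1
  refine Finset.filter_congr fun m hm => ?_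
  rw [h m (Finset.mem_range.1 hm).le, h n le_rfl]

lemma stepProb_nonneg {ω : CEnv} (hω : IsCookieEnv ω) (x : ℕ → ℤ) (n : ℕ) :
    0 ≤ stepProb ω x n := by
  have := hω (x n) (prevVisits x n)
  rw [mem_Icc] at this
  unfold stepProb
  split_ifs <;> linarith

lemma cylProb_nonneg {ω : CEnv} (hω : IsCookieEnv ω) (x₀ : ℤ) (x : ℕ → ℤ) (n : ℕ) :
    0 ≤ cylProb ω x₀ x n :=
  mul_nonneg (by split_ifs <;> norm_num) (Finset.prod_nonneg fun m _ => stepProb_nonneg hω x m)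

section Law

variable {ω : CEnv} {x₀ : ℤ} {P : Measure (ℕ → ℤ)}

lemma IsERWLaw.cyl_inter_step (hP : IsERWLaw ω x₀ P) (hω : IsCookieEnv ω) (x : ℕ → ℤ) (n : ℕ)
    (w : ℤ) :
    P (cyl x n ∩ {Y | Y (n + 1) = w}) =
      ENNReal.ofReal (stepProb ω (Function.update x (n + 1) w) n) * P (cyl x n) := by
  set y := Function.update x (n + 1) w with hy
  have hyx : ∀ m ≤ n, y m = x m := fun m hm => Function.update_of_ne (by omega) _ _
  have hset : cyl x n ∩ {Y | Y (n + 1) = w} = cyl y (n + 1) := by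
    ext Y
    constructor
    · rintro ⟨hY, hw⟩ m hm
      rcases Nat.le_succ_iff.1 hm with hm | rfl
      · rw [hY m hm, hyx m hm]
      · rw [hy, Function.update_self]; exact hw
    · intro hY
      refine ⟨fun m hm => (hY m (by omega)).trans (hyx m hm), ?_⟩
      have := hY (n + 1) le_rfl
      rwa [hy, Function.update_self] at this
  have hcyl : cyl x n = cyl y n := by
    ext Y
    exact forall₂_congr fun m hm => by rw [hyx m hm]
  rw [hset, hcyl]
  unfold cyl
  rw [hP.2 y (n + 1), hP.2 y n, mul_comm, ← ENNReal.ofReal_mul (cylProb_nonneg hω _ _ _)]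
  congr 1
  simp only [cylProb, Finset.prod_range_succ]
  ring

lemma IsERWLaw.cyl_inter_right (hP : IsERWLaw ω x₀ P) (hω : IsCookieEnv ω) (x : ℕ → ℤ) (n : ℕ) :
    P (cyl x n ∩ {Y | Y (n + 1) = x n + 1}) =
      ENNReal.ofReal (ω (x n) (prevVisits x n)) * P (cyl x n) := by
  rw [hP.cyl_inter_step hω]
  have hyx : ∀ m ≤ n, Function.update x (n + 1) (x n + 1) m = x m :=
    fun m hm => Function.update_of_ne (by omega) _ _
  simp only [stepProb, prevVisits_congr hyx, hyx n le_rfl, Function.update_self, if_true]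

lemma IsERWLaw.cyl_inter_left (hP : IsERWLaw ω x₀ P) (hω : IsCookieEnv ω) (x : ℕ → ℤ) (n : ℕ) :
    P (cyl x n ∩ {Y | Y (n + 1) = x n - 1}) =
      ENNReal.ofReal (1 - ω (x n) (prevVisits x n)) * P (cyl x n) := by
  rw [hP.cyl_inter_step hω]
  have hyx : ∀ m ≤ n, Function.update x (n + 1) (x n - 1) m = x m :=
    fun m hm => Function.update_of_ne (by omega) _ _
  have hne : x n - 1 ≠ x n + 1 := by omega
  simp only [stepProb, prevVisits_congr hyx, hyx n le_rfl, Function.update_self, if_true, if_neg hne]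

/-- The conditional probability of a step to the right, on an event determined by the past on
which the cookie in use has constant strength. -/
lemma IsERWLaw.inter_right (hP : IsERWLaw ω x₀ P) (hω : IsCookieEnv ω) {n : ℕ}
    {E : Set (ℕ → ℤ)} (hE : IsAdaptedSet n E) {p : ℝ}
    (hp : ∀ x ∈ E, ω (x n) (prevVisits x n) = p) :
    P (E ∩ {Y | Y (n + 1) = Y n + 1}) = ENNReal.ofReal p * P E := by
  refine measure_eq_mul_of_cyl P n fun x => ?_
  by_cases hx : x ∈ E
  · have h := hP.cyl_inter_right hω x n
    rw [hp x hx] at h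
    rw [← inter_assoc, inter_eq_left.2 (hE.cyl_subset hx), ← h]
    congr 1
    ext Y
    refine and_congr_right fun hY => ?_
    simp [hY n le_rfl]
  · simp [← inter_assoc, hE.cyl_inter_eq_empty hx]

/-- The analogue of `IsERWLaw.inter_right` for a step to the left. -/
lemma IsERWLaw.inter_left (hP : IsERWLaw ω x₀ P) (hω : IsCookieEnv ω) {n : ℕ}
    {E : Set (ℕ → ℤ)} (hE : IsAdaptedSet n E) {p : ℝ}
    (hp : ∀ x ∈ E, ω (x n) (prevVisits x n) = p) :
    P (E ∩ {Y | Y (n + 1) = Y n - 1}) = ENNReal.ofReal (1 - p) * P E := by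
  refine measure_eq_mul_of_cyl P n fun x => ?_
  by_cases hx : x ∈ E
  · have h := hP.cyl_inter_left hω x n
    rw [hp x hx] at h
    rw [← inter_assoc, inter_eq_left.2 (hE.cyl_subset hx), ← h]
    congr 1
    ext Y
    refine and_congr_right fun hY => ?_
    simp [hY n le_rfl]
  · simp [← inter_assoc, hE.cyl_inter_eq_empty hx]

lemma IsERWLaw.ae_start (hP : IsERWLaw ω x₀ P) : ∀ᵐ Y ∂P, Y 0 = x₀ := by
  refine measure_eq_zero_of_cyl P 0 fun x => ?_
  by_cases hx : x 0 = x₀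
  · convert measure_empty (μ := P)
    refine eq_empty_of_forall_notMem fun Y hY => hY.2 ?_
    exact (hY.1 0 le_rfl).trans hx
  · refine measure_mono_null inter_subset_left ?_
    unfold cyl
    rw [hP.2 x 0]
    simp [cylProb, hx]

/-- Almost surely the walk makes nearest-neighbor steps. -/
lemma IsERWLaw.ae_nearestNeighbor (hP : IsERWLaw ω x₀ P) (hω : IsCookieEnv ω) :
    ∀ᵐ Y ∂P, ∀ n, Y (n + 1) = Y n + 1 ∨ Y (n + 1) = Y n - 1 := by
  refine ae_all_iff.2 fun n => measure_eq_zero_of_cyl P n fun x => ?_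
  have hsub : cyl x n ∩ {Y | Y (n + 1) = Y n + 1 ∨ Y (n + 1) = Y n - 1}ᶜ ⊆
      ⋃ w : ℤ, ⋃ (_ : w ≠ x n + 1 ∧ w ≠ x n - 1), cyl x n ∩ {Y | Y (n + 1) = w} := by
    rintro Y ⟨hY, hne⟩
    refine mem_iUnion₂.2 ⟨Y (n + 1), ?_, hY, rfl⟩
    rw [← hY n le_rfl]
    simpa using hne
  refine measure_mono_null hsub (measure_iUnion_null fun w => measure_iUnion_null fun hw => ?_)
  rw [hP.cyl_inter_step hω]
  have hyx : ∀ m ≤ n, Function.update x (n + 1) w m = x m :=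
    fun m hm => Function.update_of_ne (by omega) _ _
  simp only [stepProb, hyx n le_rfl, Function.update_self, if_neg hw.1, if_neg hw.2]
  simp

end Law

lemma sqrt_average_le {d p : ℝ} (hd : 1 ≤ d) (hp : 1 / 2 ≤ p) :
    p * √(d - 1) + (1 - p) * √(d + 1) + 1 / (16 * √d ^ 3) ≤ √d := by
  have hs : 1 ≤ √d := Real.one_le_sqrt.2 hd
  have hsq : √d ^ 2 = d := Real.sq_sqrt (by linarith)
  set s := √d
  obtain ⟨r, hr⟩ : ∃ r, r = s⁻¹ := ⟨_, rfl⟩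
  have hsr : s * r = 1 := by rw [hr]; exact mul_inv_cancel₀ (by linarith)
  have hr0 : 0 < r := by rw [hr]; positivity
  have hr1 : r ≤ 1 := by rw [hr]; exact inv_le_one_of_one_le₀ hs
  have hr3 : r ^ 3 ≤ 1 := pow_le_one₀ hr0.le hr1
  have hle : √(d - 1) ≤ √(d + 1) := Real.sqrt_le_sqrt (by linarith)
  have ha : √(d - 1) ≤ s - r / 2 - r ^ 3 / 8 := by
    refine Real.sqrt_le_iff.2 ⟨by linarith, ?_⟩
    have : (s - r / 2 - r ^ 3 / 8) ^ 2 =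
        s ^ 2 - s * r - (s * r) * r ^ 2 / 4 + r ^ 2 / 4 + r ^ 4 / 8 + r ^ 6 / 64 := by ring
    rw [this, hsr, hsq]
    have : 0 < r ^ 4 := by positivity
    have : 0 < r ^ 6 := by positivity
    linarith
  have hb : √(d + 1) ≤ s + r / 2 := by
    refine Real.sqrt_le_iff.2 ⟨by linarith, ?_⟩
    have : (s + r / 2) ^ 2 = s ^ 2 + s * r + r ^ 2 / 4 := by ring
    rw [this, hsr, hsq]
    have : 0 < r ^ 2 := by positivity
    linarith
  have hinv : 1 / (16 * s ^ 3) = r ^ 3 / 16 := by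
    rw [hr]; field_simp
  rw [hinv]
  nlinarith

lemma le_add_pow_div_pow {M s : ℝ} (hM : 0 ≤ M) (hs : 0 < s) :
    M ≤ s + 16 * M ^ 4 * (1 / (16 * s ^ 3)) := by
  have h : 16 * M ^ 4 * (1 / (16 * s ^ 3)) = M ^ 4 / s ^ 3 := by field_simp
  rw [h]
  rcases le_total M s with hle | hle
  · have : 0 ≤ M ^ 4 / s ^ 3 := by positivity
    linarith
  · have : M ≤ M ^ 4 / s ^ 3 := by
      rw [le_div_iff₀ (by positivity)]
      calc M * s ^ 3 ≤ M * M ^ 3 := by gcongr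
        _ = M ^ 4 := by ring
    linarith

section Recurrence

variable {ω : CEnv} {x₀ : ℤ} {P : Measure (ℕ → ℤ)}

/-- The potential `√(k - y)` used to show that the walk returns to sites `≥ k`. -/
def leftPotential (k y : ℤ) : ℝ≥0∞ := ENNReal.ofReal √((k : ℝ) - y)

/-- A lower bound for the mean decrease of `leftPotential` in one step of the walk. -/
def leftPotentialDrop (k y : ℤ) : ℝ≥0∞ := ENNReal.ofReal (1 / (16 * √((k : ℝ) - y) ^ 3))

lemma setLIntegral_cyl_const (x : ℕ → ℤ) (n : ℕ) (f : ℤ → ℝ≥0∞) :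
    ∫⁻ Y in cyl x n, f (Y n) ∂P = f (x n) * P (cyl x n) := by
  rw [← setLIntegral_const]
  exact setLIntegral_congr_fun (measurableSet_cyl x n) fun Y hY => by simp only [hY n le_rfl]

lemma IsERWLaw.setLIntegral_cyl_succ_le (hP : IsERWLaw ω x₀ P) (hω : IsCookieEnv ω)
    (x : ℕ → ℤ) (n : ℕ) (f : ℤ → ℝ≥0∞) :
    ∫⁻ Y in cyl x n, f (Y (n + 1)) ∂P ≤
      (ENNReal.ofReal (ω (x n) (prevVisits x n)) * f (x n + 1) +
        ENNReal.ofReal (1 - ω (x n) (prevVisits x n)) * f (x n - 1)) * P (cyl x n) := by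
  have hm : ∀ w, MeasurableSet (cyl x n ∩ {Y : ℕ → ℤ | Y (n + 1) = w}) := fun w =>
    (measurableSet_cyl x n).inter (measurableSet_eq_fun (measurable_pi_apply _) measurable_const)
  have hconst : ∀ w, ∫⁻ Y in cyl x n ∩ {Y | Y (n + 1) = w}, f (Y (n + 1)) ∂P =
      f w * P (cyl x n ∩ {Y | Y (n + 1) = w}) := fun w => by
    rw [← setLIntegral_const]
    exact setLIntegral_congr_fun (hm w) fun Y hY => by rw [show Y (n + 1) = w from hY.2]
  calc ∫⁻ Y in cyl x n, f (Y (n + 1)) ∂P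
      ≤ ∫⁻ Y in (cyl x n ∩ {Y | Y (n + 1) = x n + 1}) ∪ (cyl x n ∩ {Y | Y (n + 1) = x n - 1}),
          f (Y (n + 1)) ∂P := by
        refine lintegral_mono_set' ?_
        filter_upwards [hP.ae_nearestNeighbor hω] with Y hY hc
        have hc' : Y ∈ cyl x n := hc
        rcases hY n with h | h <;> rw [hc' n le_rfl] at h
        · exact Or.inl ⟨hc, h⟩
        · exact Or.inr ⟨hc, h⟩
    _ ≤ _ := lintegral_union_le _ _ _
    _ = _ := by
        rw [hconst, hconst, hP.cyl_inter_right hω, hP.cyl_inter_left hω]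
        ring

lemma IsERWLaw.setLIntegral_leftPotential_le (hP : IsERWLaw ω x₀ P) (hω : IsCookieEnv ω)
    {k : ℤ} {n : ℕ} {E : Set (ℕ → ℤ)} (hE : IsAdaptedSet n E) (hk : ∀ Y ∈ E, Y n < k) :
    ∫⁻ Y in E, leftPotential k (Y (n + 1)) ∂P + ∫⁻ Y in E, leftPotentialDrop k (Y n) ∂P ≤
      ∫⁻ Y in E, leftPotential k (Y n) ∂P := by
  have hmeas : ∀ f : ℤ → ℝ≥0∞, Measurable fun Y : ℕ → ℤ => f (Y n) := fun f =>
    (measurable_of_countable f).comp (measurable_pi_apply n)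
  rw [← lintegral_add_right _ (hmeas _)]
  refine lintegral_le_of_cyl _ n fun x => ?_
  rw [Measure.restrict_restrict (measurableSet_cyl x n)]
  by_cases hx : x ∈ E
  · rw [inter_eq_left.2 (hE.cyl_subset hx), lintegral_add_right _ (hmeas _),
      setLIntegral_cyl_const, setLIntegral_cyl_const]
    refine (add_le_add_left (hP.setLIntegral_cyl_succ_le hω x n _) _).trans ?_
    rw [← add_mul]
    gcongr
    have hp := hω (x n) (prevVisits x n)
    rw [mem_Icc] at hp
    have hd : (1 : ℝ) ≤ (k : ℝ) - x n := by
      have : x n + 1 ≤ k := hk x hx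
      have : ((x n + 1 : ℤ) : ℝ) ≤ k := by exact_mod_cast this
      push_cast at this
      linarith
    have h := sqrt_average_le hd hp.1
    unfold leftPotential leftPotentialDrop
    push_cast
    rw [← ENNReal.ofReal_mul (by linarith), ← ENNReal.ofReal_mul (by linarith),
      ← ENNReal.ofReal_add (mul_nonneg (by linarith) (Real.sqrt_nonneg _))
        (mul_nonneg (by linarith) (Real.sqrt_nonneg _)),
      ← ENNReal.ofReal_add (add_nonneg (mul_nonneg (by linarith) (Real.sqrt_nonneg _))
        (mul_nonneg (by linarith) (Real.sqrt_nonneg _))) (by positivity)]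
    refine ENNReal.ofReal_le_ofReal ?_
    rwa [← sub_sub, sub_sub_eq_add_sub, add_sub_right_comm]
  · simp [hE.cyl_inter_eq_empty hx]

lemma natCast_mul_measure_le_leftPotential {k : ℤ} {n : ℕ} {E : Set (ℕ → ℤ)}
    (hE : MeasurableSet E) (hk : ∀ Y ∈ E, Y n < k) (M : ℕ) :
    M * P E ≤ ∫⁻ Y in E, leftPotential k (Y n) ∂P +
      ENNReal.ofReal (16 * M ^ 4) * ∫⁻ Y in E, leftPotentialDrop k (Y n) ∂P := by
  have hmeas : ∀ f : ℤ → ℝ≥0∞, Measurable fun Y : ℕ → ℤ => f (Y n) := fun f =>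
    (measurable_of_countable f).comp (measurable_pi_apply n)
  rw [← lintegral_const_mul _ (hmeas _), ← lintegral_add_left (hmeas _), ← setLIntegral_const]
  refine setLIntegral_mono' hE fun Y hY => ?_
  have hd : (0 : ℝ) < (k : ℝ) - Y n := sub_pos.2 (by exact_mod_cast hk Y hY)
  have h := le_add_pow_div_pow (Nat.cast_nonneg M) (Real.sqrt_pos.2 hd)
  unfold leftPotential leftPotentialDrop
  rw [← ENNReal.ofReal_mul (by positivity), ← ENNReal.ofReal_add (by positivity)
    (by positivity), ← ENNReal.ofReal_natCast M]
  exact ENNReal.ofReal_le_ofReal h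

/-- Started from a given history, the walk almost surely does not stay to the left of `k`. -/
lemma IsERWLaw.measure_cyl_inter_stay_left (hP : IsERWLaw ω x₀ P) (hω : IsCookieEnv ω)
    (k : ℤ) (x : ℕ → ℤ) (n : ℕ) : P (cyl x n ∩ {Y | ∀ m, n ≤ m → Y m < k}) = 0 := by
  have := hP.1
  set S := cyl x n ∩ {Y | ∀ m, n ≤ m → Y m < k}
  set E : ℕ → Set (ℕ → ℤ) := fun j => cyl x n ∩ {Y | ∀ m, n ≤ m → m ≤ n + j → Y m < k}
  have hSE : ∀ j, S ⊆ E j := fun j Y hY => ⟨hY.1, fun m hm _ => hY.2 m hm⟩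
  have hanti : ∀ j, E (j + 1) ⊆ E j := fun j Y hY => ⟨hY.1, fun m hm hm' => hY.2 m hm (by omega)⟩
  have hadapted : ∀ j, IsAdaptedSet (n + j) (E j) := fun j Y Y' h hY =>
    ⟨fun m hm => (h m (by omega)).symm.trans (hY.1 m hm),
      fun m hm hm' => (h m hm') ▸ hY.2 m hm hm'⟩
  have hlt : ∀ j, ∀ Y ∈ E j, Y (n + j) < k := fun j Y hY => hY.2 _ (by omega) le_rfl
  set u : ℕ → ℝ≥0∞ := fun j => ∫⁻ Y in E j, leftPotential k (Y (n + j)) ∂P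
  set e : ℕ → ℝ≥0∞ := fun j => ∫⁻ Y in E j, leftPotentialDrop k (Y (n + j)) ∂P
  have hstep : ∀ j, u (j + 1) + e j ≤ u j := fun j =>
    (add_le_add_left (lintegral_mono_set (hanti j)) _).trans
      (hP.setLIntegral_leftPotential_le hω (hadapted j) (hlt j))
  have hsum : ∀ j, u j + ∑ i ∈ Finset.range j, e i ≤ u 0 := fun j => by
    induction j with
    | zero => simp
    | succ j ih =>
      rw [Finset.sum_range_succ, add_comm _ (e j), ← add_assoc]
      exact (add_le_add_left (hstep j) _).trans ih
  have hu0 : u 0 ≠ ∞ := by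
    have : u 0 ≤ leftPotential k (x n) * P (cyl x n) :=
      (lintegral_mono_set inter_subset_left).trans_eq (setLIntegral_cyl_const x n _)
    exact ne_top_of_le_ne_top (ENNReal.mul_ne_top ENNReal.ofReal_ne_top (measure_ne_top _ _)) this
  have htsum : ∑' j, e j ≠ ∞ := by
    refine ne_top_of_le_ne_top hu0 ?_
    rw [ENNReal.tsum_eq_iSup_nat]
    exact iSup_le fun j => le_add_self.trans (hsum j)
  have hlim := ENNReal.tendsto_atTop_zero_of_tsum_ne_top htsum
  have hbound : ∀ (M j : ℕ), M * P S ≤ u 0 + ENNReal.ofReal (16 * M ^ 4) * e j := fun M j =>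
    calc M * P S ≤ M * P (E j) := mul_le_mul_right (measure_mono (hSE j)) _
      _ ≤ u j + ENNReal.ofReal (16 * M ^ 4) * e j :=
          natCast_mul_measure_le_leftPotential (hadapted j).measurableSet (hlt j) M
      _ ≤ _ := add_le_add_left (le_self_add.trans (hsum j)) _
  have hbound' : ∀ M : ℕ, M * P S ≤ u 0 := fun M => by
    have h : Tendsto (fun j => u 0 + ENNReal.ofReal (16 * M ^ 4) * e j) atTop (𝓝 (u 0)) := by
      have h := ENNReal.Tendsto.const_mul (a := ENNReal.ofReal (16 * M ^ 4)) hlim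
        (Or.inr ENNReal.ofReal_ne_top)
      rw [mul_zero] at h
      exact (tendsto_const_nhds.add h).trans_eq (by rw [add_zero])
    exact ge_of_tendsto' h (hbound M)
  by_contra hne
  obtain ⟨M, hM⟩ := ENNReal.exists_nat_mul_gt hne hu0
  exact absurd (hbound' M) (not_le.2 hM)

/-- Almost surely the walk is at a site `≥ k` infinitely often. -/
lemma IsERWLaw.ae_infinite_ge (hP : IsERWLaw ω x₀ P) (hω : IsCookieEnv ω) (k : ℤ) :
    ∀ᵐ Y ∂P, {n | k ≤ Y n}.Infinite := by
  have h : ∀ᵐ Y ∂P, ∀ n, ∃ m, n ≤ m ∧ k ≤ Y m := by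
    refine ae_all_iff.2 fun n => measure_eq_zero_of_cyl P n fun x => ?_
    convert hP.measure_cyl_inter_stay_left hω k x n using 3
    ext Y
    simp
  filter_upwards [h] with Y hY
  exact Set.infinite_of_not_bddAbove fun ⟨b, hb⟩ => by
    obtain ⟨m, hm, hkm⟩ := hY (b + 1)
    have : m ≤ b := hb hkm
    omega

end Recurrence

section Deterministic

variable {k : ℤ} {Y : ℕ → ℤ}

lemma tauT_eq_nth (hY : {n | k ≤ Y n}.Infinite) (M : ℕ) :
    tauT k Y M = (Nat.nth (fun n => k ≤ Y n) M : ℕ) := by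
  have hcount : ∀ {n}, k ≤ Y n → Nat.nth (fun n => k ≤ Y n) (Nat.count (fun n => k ≤ Y n) n) = n :=
    fun h => Nat.nth_count (p := fun n => k ≤ Y n) h
  induction M with
  | zero =>
    refine IsLeast.csInf_eq ⟨⟨_, rfl, Nat.nth_mem_of_infinite hY 0⟩, ?_⟩
    rintro _ ⟨n, rfl, hn⟩
    rw [Nat.cast_le, ← hcount hn]
    exact Nat.nth_monotone hY (Nat.zero_le _)
  | succ M ih =>
    refine IsLeast.csInf_eq ⟨⟨_, rfl, ?_, Nat.nth_mem_of_infinite hY (M + 1)⟩, ?_⟩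
    · rw [ih, Nat.cast_lt]
      exact Nat.nth_strictMono hY M.lt_succ_self
    · rintro _ ⟨n, rfl, hlt, hn⟩
      rw [ih, Nat.cast_lt, ← hcount hn, Nat.nth_lt_nth hY] at hlt
      rw [Nat.cast_le, ← hcount hn, Nat.nth_le_nth hY]
      exact hlt

lemma obsSeq_eq_nth (hY : {n | k ≤ Y n}.Infinite) (M : ℕ) :
    obsSeq k Y M = Y (Nat.nth (fun n => k ≤ Y n) M) := by
  rw [obsSeq, tauT_eq_nth hY, ENat.toNat_natCast]

lemma le_obsSeq (hY : {n | k ≤ Y n}.Infinite) (M : ℕ) : k ≤ obsSeq k Y M := by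
  rw [obsSeq_eq_nth hY]
  exact Nat.nth_mem_of_infinite hY M

lemma obsSeq_count (hY : {n | k ≤ Y n}.Infinite) {n : ℕ} (hn : k ≤ Y n) :
    obsSeq k Y (Nat.count (fun m => k ≤ Y m) n) = Y n := by
  rw [obsSeq_eq_nth hY, Nat.nth_count (p := fun m => k ≤ Y m) hn]

lemma mem_Rset_iff_obsSeq_mem (hY : {n | k ≤ Y n}.Infinite) :
    Y ∈ Rset k ↔ obsSeq k Y ∈ Rset k := by
  constructor
  · intro h N
    obtain ⟨n, hn, hYn⟩ := h (Nat.nth (fun m => k ≤ Y m) N)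
    refine ⟨_, ?_, (obsSeq_count hY hYn.ge).trans hYn⟩
    rw [ge_iff_le, ← Nat.nth_le_nth hY, Nat.nth_count (p := fun m => k ≤ Y m) hYn.ge]
    exact hn
  · intro h N
    obtain ⟨n, hn, hYn⟩ := h N
    exact ⟨_, hn.trans ((Nat.nth_strictMono hY).le_apply), (obsSeq_eq_nth hY n).symm.trans hYn⟩

lemma obsSeq_zero_eq (hY : {n | k ≤ Y n}.Infinite)
    (hnn : ∀ n, Y (n + 1) = Y n + 1 ∨ Y (n + 1) = Y n - 1) (h0 : Y 0 ≤ k) :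
    obsSeq k Y 0 = k := by
  refine le_antisymm ?_ (le_obsSeq hY 0)
  rw [obsSeq_eq_nth hY]
  cases hm : Nat.nth (fun n => k ≤ Y n) 0 with
  | zero => exact h0
  | succ m =>
    have : ¬ k ≤ Y m := fun h => by
      have h' := Nat.nth_monotone hY (Nat.zero_le (Nat.count (fun n => k ≤ Y n) m))
      rw [Nat.nth_count (p := fun n => k ≤ Y n) h, hm] at h'
      omega
    have := hnn m
    omega

lemma obsSeq_succ_count_of_le (hY : {n | k ≤ Y n}.Infinite) {n : ℕ} (hn : k ≤ Y n)
    (hn' : k ≤ Y (n + 1)) :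
    obsSeq k Y (Nat.count (fun m => k ≤ Y m) n + 1) = Y (n + 1) := by
  rw [← obsSeq_count hY hn', Nat.count_succ, if_pos hn]

lemma obsSeq_succ_count_of_lt (hY : {n | k ≤ Y n}.Infinite)
    (hnn : ∀ n, Y (n + 1) = Y n + 1 ∨ Y (n + 1) = Y n - 1) {n : ℕ} (hn : k ≤ Y n)
    (hn' : Y (n + 1) < k) :
    obsSeq k Y (Nat.count (fun m => k ≤ Y m) n + 1) = k := by
  refine le_antisymm ?_ (le_obsSeq hY _)
  rw [obsSeq_eq_nth hY]
  set M := Nat.count (fun m => k ≤ Y m) n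
  have hM : Nat.nth (fun m => k ≤ Y m) M = n := Nat.nth_count (p := fun m => k ≤ Y m) hn
  have hlt := Nat.nth_strictMono hY M.lt_succ_self
  have hmem : k ≤ Y (Nat.nth (fun m => k ≤ Y m) (M + 1)) := Nat.nth_mem_of_infinite hY (M + 1)
  rw [Nat.succ_eq_add_one, hM] at hlt
  obtain ⟨m, hm⟩ : ∃ m, Nat.nth (fun m => k ≤ Y m) (M + 1) = m + 1 :=
    Nat.exists_eq_succ_of_ne_zero (by omega)
  rw [hm] at hlt hmem ⊢
  have hne : m ≠ n := by rintro rfl; omega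
  have : ¬ k ≤ Y m := fun h => by
    have h' := Nat.le_nth_of_lt_nth_succ (p := fun m => k ≤ Y m) (k := M) (a := m) (by omega) h
    omega
  have := hnn m
  omega

/-- Time `n` is the `M`-th time (counted from `0`) at which the walk is at a site `≥ k`, and
until then the walk observed at sites `≥ k` follows `z`. -/
def visitAt (k : ℤ) (M : ℕ) (z : ℕ → ℤ) (n : ℕ) : Set (ℕ → ℤ) :=
  {Y | k ≤ Y n ∧ Nat.count (fun m => k ≤ Y m) n = M ∧
    ∀ m ≤ n, k ≤ Y m → Y m = z (Nat.count (fun i => k ≤ Y i) m)}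

lemma count_congr_of_le {Y Y' : ℕ → ℤ} {n : ℕ} (h : ∀ m ≤ n, Y m = Y' m) :
    Nat.count (fun m => k ≤ Y m) n = Nat.count (fun m => k ≤ Y' m) n := by
  simp only [Nat.count_eq_card_filter_range]
  congr 1
  refine Finset.filter_congr fun m hm => ?_
  rw [h m (Finset.mem_range.1 hm).le]

lemma isAdaptedSet_visitAt (k : ℤ) (M : ℕ) (z : ℕ → ℤ) (n : ℕ) :
    IsAdaptedSet n (visitAt k M z n) := by
  rintro Y Y' h ⟨h1, h2, h3⟩
  refine ⟨h n le_rfl ▸ h1, (count_congr_of_le h).symm.trans h2, fun m hm hk => ?_⟩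
  rw [← count_congr_of_le fun i hi => h i (hi.trans hm), ← h m hm]
  exact h3 m hm (h m hm ▸ hk)

lemma pairwise_disjoint_visitAt (k : ℤ) (M : ℕ) (z : ℕ → ℤ) :
    Pairwise (Function.onFun Disjoint (visitAt k M z)) := fun _ _ hne =>
  Set.disjoint_left.2 fun Y h h' => hne <|
    Nat.count_injective (p := fun m => k ≤ Y m) h.1 h'.1 (h.2.1.trans h'.2.1.symm)

lemma visitAt_apply_eq {M n : ℕ} {z : ℕ → ℤ} (h : Y ∈ visitAt k M z n) : Y n = z M := by
  have := h.2.2 n le_rfl h.1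
  rwa [h.2.1] at this

/-- The number of visits to a site `≥ k` can be read off the walk observed at sites `≥ k`. -/
lemma prevVisits_eq_of_mem_visitAt {M n : ℕ} {z : ℕ → ℤ} (h : Y ∈ visitAt k M z n) :
    prevVisits Y n = prevVisits z M := by
  have hn := visitAt_apply_eq h
  obtain ⟨h1, h2, h3⟩ := h
  refine Finset.card_bij (fun m _ => Nat.count (fun i => k ≤ Y i) m) ?_ ?_ ?_
  · intro m hm
    simp only [Finset.mem_filter, Finset.mem_range] at hm ⊢
    have hk : k ≤ Y m := hm.2 ▸ h1
    refine ⟨h2 ▸ Nat.count_strict_mono (p := fun i => k ≤ Y i) hk hm.1, ?_⟩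
    rw [← h3 m hm.1.le hk, hm.2, hn]
  · intro m hm m' hm' heq
    simp only [Finset.mem_filter, Finset.mem_range] at hm hm'
    exact Nat.count_injective (p := fun i => k ≤ Y i) (hm.2 ▸ h1) (hm'.2 ▸ h1) heq
  · intro j hj
    simp only [Finset.mem_filter, Finset.mem_range] at hj
    have hjn : j < Nat.count (fun i => k ≤ Y i) n := h2 ▸ hj.1
    have hcard : ∀ hf : {i | k ≤ Y i}.Finite, j < hf.toFinset.card := fun hf =>
      hjn.trans_le (Nat.count_le_card hf n)
    have hlt := Nat.nth_lt_of_lt_count hjn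
    have hc : Nat.count (fun i => k ≤ Y i) (Nat.nth (fun i => k ≤ Y i) j) = j :=
      Nat.count_nth hcard
    refine ⟨Nat.nth (fun i => k ≤ Y i) j, ?_, hc⟩
    simp only [Finset.mem_filter, Finset.mem_range]
    refine ⟨hlt, ?_⟩
    rw [h3 _ hlt.le (Nat.nth_mem j hcard), hc, hj.2, hn]

lemma obsSeq_mem_cyl_iff (hY : {n | k ≤ Y n}.Infinite) (z : ℕ → ℤ) (M : ℕ) :
    obsSeq k Y ∈ cyl z M ↔ ∃ n, Y ∈ visitAt k M z n := by
  constructor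
  · intro h
    refine ⟨Nat.nth (fun m => k ≤ Y m) M, Nat.nth_mem_of_infinite hY M,
      Nat.count_nth_of_infinite hY M, fun m hm hk => ?_⟩
    rw [← h, obsSeq_count hY hk]
    have := Nat.count_monotone (fun m => k ≤ Y m) hm
    rwa [Nat.count_nth_of_infinite hY M] at this
  · rintro ⟨n, h1, h2, h3⟩ j hj
    have hjn : Nat.nth (fun m => k ≤ Y m) j ≤ n := by
      rw [← Nat.nth_count (p := fun m => k ≤ Y m) h1, h2]
      exact Nat.nth_monotone hY hj
    rw [obsSeq_eq_nth hY, h3 _ hjn (Nat.nth_mem_of_infinite hY j), Nat.count_nth_of_infinite hY]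

lemma obsSeq_mem_cyl_succ_iff (hY : {n | k ≤ Y n}.Infinite)
    (hnn : ∀ n, Y (n + 1) = Y n + 1 ∨ Y (n + 1) = Y n - 1) (z : ℕ → ℤ) (M : ℕ) :
    obsSeq k Y ∈ cyl z (M + 1) ↔ ∃ n, Y ∈ visitAt k M z n ∧
      (Y (n + 1) = Y n + 1 ∧ z (M + 1) = z M + 1 ∨
        Y (n + 1) = Y n - 1 ∧ z (M + 1) = max (z M - 1) k) := by
  have hsucc : obsSeq k Y ∈ cyl z (M + 1) ↔
      obsSeq k Y ∈ cyl z M ∧ obsSeq k Y (M + 1) = z (M + 1) := by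
    refine ⟨fun h => ⟨fun m hm => h m (by omega), h _ le_rfl⟩, fun h m hm => ?_⟩
    rcases Nat.le_succ_iff.1 hm with hm | rfl
    exacts [h.1 m hm, h.2]
  rw [hsucc, obsSeq_mem_cyl_iff hY, exists_and_right.symm]
  refine exists_congr fun n => and_congr_right fun hv => ?_
  have hz := visitAt_apply_eq hv
  obtain ⟨h1, h2, -⟩ := hv
  rw [← h2] at hz ⊢
  by_cases hn' : k ≤ Y (n + 1)
  · rw [obsSeq_succ_count_of_le hY h1 hn']
    have := hnn n
    omega
  · rw [obsSeq_succ_count_of_lt hY hnn h1 (not_le.1 hn')]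
    have := hnn n
    omega

end Deterministic

section Observed

variable {ω : CEnv} {x₀ : ℤ} {P : Measure (ℕ → ℤ)}

lemma measurableSet_Rset (k : ℤ) : MeasurableSet (Rset k) := by
  have : Rset k = ⋂ N : ℕ, ⋃ n, ⋃ (_ : n ≥ N), {Y | Y n = k} := by
    ext Y; simp [Rset]
  rw [this]
  exact MeasurableSet.iInter fun N => MeasurableSet.iUnion fun n => MeasurableSet.iUnion fun _ =>
    measurableSet_eq_fun (measurable_pi_apply n) measurable_const

lemma IsERWLaw.aemeasurable_obsSeq (hP : IsERWLaw ω x₀ P) (hω : IsCookieEnv ω) (k : ℤ) :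
    AEMeasurable (fun Y => obsSeq k Y) P := by
  refine aemeasurable_pi_iff.2 fun M => NullMeasurable.aemeasurable fun S _ => ?_
  have hmeas : MeasurableSet (⋃ n, {Y : ℕ → ℤ | k ≤ Y n ∧
      Nat.count (fun m => k ≤ Y m) n = M ∧ Y n ∈ S}) := by
    refine MeasurableSet.iUnion fun n => IsAdaptedSet.measurableSet (n := n) ?_
    rintro Y Y' h ⟨h1, h2, h3⟩
    exact ⟨h n le_rfl ▸ h1, (count_congr_of_le h).symm.trans h2, h n le_rfl ▸ h3⟩
  refine hmeas.nullMeasurableSet.congr (eventuallyEq_set.2 ?_)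
  filter_upwards [hP.ae_infinite_ge hω k] with Y hY
  simp only [mem_iUnion, mem_ofPred_eq, mem_preimage]
  constructor
  · rintro ⟨n, h1, rfl, h3⟩
    rwa [obsSeq_count hY h1]
  · intro h
    rw [obsSeq_eq_nth hY] at h
    exact ⟨_, Nat.nth_mem_of_infinite hY M, Nat.count_nth_of_infinite hY M, h⟩

lemma IsERWLaw.measure_obsSeq_cyl_zero (hP : IsERWLaw ω x₀ P) (hω : IsCookieEnv ω) {k : ℤ}
    (hk : x₀ ≤ k) (z : ℕ → ℤ) :
    P {Y | obsSeq k Y ∈ cyl z 0} = if z 0 = k then 1 else 0 := by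
  have := hP.1
  have h : {Y | obsSeq k Y ∈ cyl z 0} =ᵐ[P] {_Y : ℕ → ℤ | z 0 = k} := by
    refine eventuallyEq_set.2 ?_
    filter_upwards [hP.ae_infinite_ge hω k, hP.ae_nearestNeighbor hω, hP.ae_start]
      with Y hY hnn h0
    have := obsSeq_zero_eq hY hnn (h0.trans_le hk)
    simp [cyl, this, eq_comm]
  rw [measure_congr h]
  split_ifs with hz <;> simp [hz]

lemma IsERWLaw.measure_obsSeq_cyl_eq_zero (hP : IsERWLaw ω x₀ P) (hω : IsCookieEnv ω) {k : ℤ}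
    {z : ℕ → ℤ} {M : ℕ} (hz : z M < k) : P {Y | obsSeq k Y ∈ cyl z M} = 0 := by
  refine measure_mono_null (fun Y hY => ?_) (ae_iff.1 (hP.ae_infinite_ge hω k))
  exact fun hinf => hz.not_ge (hY M le_rfl ▸ le_obsSeq hinf M)

/-- The transition probabilities of the walk observed at sites `≥ k`. -/
lemma IsERWLaw.measure_obsSeq_cyl_succ (hP : IsERWLaw ω x₀ P) (hω : IsCookieEnv ω) (k : ℤ)
    (z : ℕ → ℤ) (M : ℕ) :
    P {Y | obsSeq k Y ∈ cyl z (M + 1)} =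
      ((if z (M + 1) = z M + 1 then ENNReal.ofReal (ω (z M) (prevVisits z M)) else 0) +
        if z (M + 1) = max (z M - 1) k then ENNReal.ofReal (1 - ω (z M) (prevVisits z M)) else 0) *
      P {Y | obsSeq k Y ∈ cyl z M} := by
  have hR : ∀ n, MeasurableSet {Y : ℕ → ℤ | Y (n + 1) = Y n + 1} := fun n =>
    measurableSet_eq_fun (measurable_pi_apply _) ((measurable_pi_apply n).add_const 1)
  have hL : ∀ n, MeasurableSet {Y : ℕ → ℤ | Y (n + 1) = Y n - 1} := fun n =>
    measurableSet_eq_fun (measurable_pi_apply _) ((measurable_pi_apply n).sub_const 1)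
  have hV := fun n => (isAdaptedSet_visitAt k M z n).measurableSet
  set A : ℕ → Set (ℕ → ℤ) := fun n =>
    visitAt k M z n ∩ ({Y | Y (n + 1) = Y n + 1} ∩ {_Y | z (M + 1) = z M + 1})
  set B : ℕ → Set (ℕ → ℤ) := fun n =>
    visitAt k M z n ∩ ({Y | Y (n + 1) = Y n - 1} ∩ {_Y | z (M + 1) = max (z M - 1) k})
  have hA : ∀ n, MeasurableSet (A n) := fun n =>
    (hV n).inter ((hR n).inter (MeasurableSet.const _))
  have hB : ∀ n, MeasurableSet (B n) := fun n =>
    (hV n).inter ((hL n).inter (MeasurableSet.const _))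
  have h1 : {Y | obsSeq k Y ∈ cyl z M} =ᵐ[P] ⋃ n, visitAt k M z n := by
    refine eventuallyEq_set.2 ?_
    filter_upwards [hP.ae_infinite_ge hω k] with Y hY
    rw [mem_iUnion]
    exact obsSeq_mem_cyl_iff hY z M
  have h2 : {Y | obsSeq k Y ∈ cyl z (M + 1)} =ᵐ[P] ⋃ n, (A n ∪ B n) := by
    refine eventuallyEq_set.2 ?_
    filter_upwards [hP.ae_infinite_ge hω k, hP.ae_nearestNeighbor hω] with Y hY hnn
    rw [mem_iUnion]
    refine (obsSeq_mem_cyl_succ_iff hY hnn z M).trans (exists_congr fun n => ?_)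
    exact and_or_left
  rw [measure_congr h1, measure_congr h2,
    measure_iUnion (pairwise_disjoint_visitAt k M z) hV,
    measure_iUnion _ fun n => (hA n).union (hB n), ← ENNReal.tsum_mul_left]
  · refine tsum_congr fun n => ?_
    have hp : ∀ Y ∈ visitAt k M z n, ω (Y n) (prevVisits Y n) = ω (z M) (prevVisits z M) :=
      fun Y hY => by rw [visitAt_apply_eq hY, prevVisits_eq_of_mem_visitAt hY]
    have hdisj : Disjoint (A n) (B n) := Set.disjoint_left.2 fun Y hY hY' => by
      have h : Y (n + 1) = Y n + 1 := hY.2.1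
      have h' : Y (n + 1) = Y n - 1 := hY'.2.1
      omega
    rw [measure_union hdisj (hB n), add_mul]
    congr 1
    · rw [ite_mul, zero_mul, ← hP.inter_right hω (isAdaptedSet_visitAt k M z n) hp]
      split_ifs with h <;> simp [A, h]
    · rw [ite_mul, zero_mul, ← hP.inter_left hω (isAdaptedSet_visitAt k M z n) hp]
      split_ifs with h <;> simp [B, h]
  · exact (pairwise_disjoint_visitAt k M z).mono fun i j h =>
      h.mono (union_subset inter_subset_left inter_subset_left)
        (union_subset inter_subset_left inter_subset_left)

lemma IsERWLaw.measure_Rset (hP : IsERWLaw ω x₀ P) (hω : IsCookieEnv ω) (k : ℤ) :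
    P (Rset k) = P.map (fun Y => obsSeq k Y) (Rset k) := by
  rw [Measure.map_apply_of_aemeasurable (hP.aemeasurable_obsSeq hω k) (measurableSet_Rset k)]
  refine measure_congr (eventuallyEq_set.2 ?_)
  filter_upwards [hP.ae_infinite_ge hω k] with Y hY
  exact mem_Rset_iff_obsSeq_mem hY

end Observed

/-- Lemma 3. If `x₁, x₂ ≤ k` and `ω₁, ω₂` agree at all sites `≥ k`,
then `(X_{τ_{k,m}})_m` has the same distribution under `P_{x₁,ω₁}` and `P_{x₂,ω₂}`;
in particular `P_{x₁,ω₁}[R_k] = P_{x₂,ω₂}[R_k]`. -/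
theorem erw_right_part_distribution (ω₁ ω₂ : CEnv)
    (hω₁ : IsCookieEnv ω₁) (hω₂ : IsCookieEnv ω₂)
    (k x₁ x₂ : ℤ) (h₁ : x₁ ≤ k) (h₂ : x₂ ≤ k)
    (henv : ∀ x : ℤ, k ≤ x → ω₁ x = ω₂ x)
    (P₁ P₂ : Measure (ℕ → ℤ)) (hP₁ : IsERWLaw ω₁ x₁ P₁) (hP₂ : IsERWLaw ω₂ x₂ P₂) :
    P₁.map (fun Y => obsSeq k Y) = P₂.map (fun Y => obsSeq k Y) ∧
      P₁ (Rset k) = P₂ (Rset k) := by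
  have hcyl : ∀ (z : ℕ → ℤ) (M : ℕ),
      P₁ {Y | obsSeq k Y ∈ cyl z M} = P₂ {Y | obsSeq k Y ∈ cyl z M} := by
    intro z M
    induction M with
    | zero => rw [hP₁.measure_obsSeq_cyl_zero hω₁ h₁, hP₂.measure_obsSeq_cyl_zero hω₂ h₂]
    | succ M ih =>
      rw [hP₁.measure_obsSeq_cyl_succ hω₁, hP₂.measure_obsSeq_cyl_succ hω₂, ih]
      rcases le_or_gt k (z M) with hz | hz
      · rw [henv _ hz]
      · rw [hP₂.measure_obsSeq_cyl_eq_zero hω₂ hz, mul_zero, mul_zero]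
  have := hP₁.1
  have hmap : P₁.map (fun Y => obsSeq k Y) = P₂.map (fun Y => obsSeq k Y) := by
    refine measure_ext_of_cyl fun z M => ?_
    rw [Measure.map_apply_of_aemeasurable (hP₁.aemeasurable_obsSeq hω₁ k) (measurableSet_cyl z M),
      Measure.map_apply_of_aemeasurable (hP₂.aemeasurable_obsSeq hω₂ k) (measurableSet_cyl z M)]
    exact hcyl z M
  exact ⟨hmap, by rw [hP₁.measure_Rset hω₁, hP₂.measure_Rset hω₂, hmap]⟩

end
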